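/- The operator T^ℓ is a γ-contraction with respect to the sup norm: ‖T^ℓ q_1 − T^ℓ q_2‖_∞ ≤ γ ‖q_1 − q_2‖_∞ for all q_1, q_2 : S × A → ℝ. Consequently T^ℓ has a unique fixed point q*, and for every initial mapping q^0 : S × A → ℝ the sequence q^{n+1} = T^ℓ q^n converges to q*. -/

import Mathlib

open MeasureTheory

/-- `ℓ_max = max_a ℓ_a` over a nonempty finite action set. -/
noncomputable def lmax {α : Type*} [Fintype α] [Nonempty α] (ℓ : α → ℝ) : ℝ :=
  Finset.univ.sup' Finset.univ_nonempty ℓ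

/-- Mixture density `u_π(x) = Σ_a (π_a/(2ℓ_a)) · 1_{[−ℓ_a, ℓ_a]}(x)`. -/
noncomputable def uMix {α : Type*} [Fintype α] (ℓ : α → ℝ) (π : α → ℝ) (x : ℝ) : ℝ :=
  ∑ a, (π a / (2 * ℓ a)) * Set.indicator (Set.Icc (-ℓ a) (ℓ a)) (fun _ => (1 : ℝ)) x

/-- Uniform density `u•(x) = (1/(2ℓ_max)) · 1_{[−ℓ_max, ℓ_max]}(x)`. -/
noncomputable def uUnif {α : Type*} [Fintype α] [Nonempty α] (ℓ : α → ℝ) (x : ℝ) : ℝ :=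
  (1 / (2 * lmax ℓ)) * Set.indicator (Set.Icc (-(lmax ℓ)) (lmax ℓ)) (fun _ => (1 : ℝ)) x

/-- Kullback–Leibler divergence `D(π) = ∫ u_π log(u_π/u•)`; the convention
`0 · log 0 = 0` is automatic since `Real.log 0 = 0` in Lean. -/
noncomputable def KLdiv {α : Type*} [Fintype α] [Nonempty α] (ℓ : α → ℝ) (π : α → ℝ) : ℝ :=
  ∫ x : ℝ, uMix ℓ π x * Real.log (uMix ℓ π x / uUnif ℓ x)

/-- A policy: nonnegative entries summing to one. -/
def IsPolicy {α : Type*} [Fintype α] (π : α → ℝ) : Prop :=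
  (∀ a, 0 ≤ π a) ∧ ∑ a, π a = 1

/-- The soft value `V(x) = sup_π (Σ_a π_a x_a − κ D(π))`. -/
noncomputable def softV {α : Type*} [Fintype α] [Nonempty α] (ℓ : α → ℝ) (κ : ℝ)
    (x : α → ℝ) : ℝ :=
  sSup {y : ℝ | ∃ π, IsPolicy π ∧ y = (∑ a, π a * x a) - κ * KLdiv ℓ π}

/-- `P(·|s,a)` is a probability distribution on `S` for every `(s,a)`. -/
def IsKernel {S A : Type*} [Fintype S] (P : S → A → S → ℝ) : Prop :=
  ∀ s a, (∀ s', 0 ≤ P s a s') ∧ ∑ s', P s a s' = 1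

/-- The operator `(T^ℓ q)(s,a) = r(s,a) + γ Σ_{s'} P(s'|s,a) V_{s'}^ℓ(q(s',·))`. -/
noncomputable def Toper {S A : Type*} [Fintype S] [Fintype A] [Nonempty A]
    (P : S → A → S → ℝ) (r : S → A → ℝ) (γ κ : ℝ) (ℓ : S → A → ℝ)
    (q : S → A → ℝ) : S → A → ℝ :=
  fun s a => r s a + γ * ∑ s', P s a s' * softV (ℓ s') κ (q s')

/-- Sup norm `‖q‖_∞ = max_{(s,a)} |q(s,a)|`. -/
noncomputable def supNorm {S A : Type*} [Fintype S] [Fintype A] [Nonempty S] [Nonempty A]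
    (q : S → A → ℝ) : ℝ :=
  Finset.univ.sup' Finset.univ_nonempty (fun p : S × A => |q p.1 p.2|)

/-- The uncertainty-backup operator
`(L ℓ)(s,a) = c(s,a) + γ Σ_{s'} P(s'|s,a) max_{a'} ℓ(s',a')`. -/
noncomputable def Lop {S A : Type*} [Fintype S] [Fintype A] [Nonempty A]
    (P : S → A → S → ℝ) (γ : ℝ) (c : S → A → ℝ) (ℓ : S → A → ℝ) : S → A → ℝ :=
  fun s a => c s a + γ * ∑ s', P s a s' *
    Finset.univ.sup' Finset.univ_nonempty (fun a' => ℓ s' a')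

theorem sub_le_mul_log_div {u v : ℝ} (hu : 0 ≤ u) (hv : 0 < v) :
    u - v ≤ u * Real.log (u / v) := by
  rcases hu.eq_or_lt with rfl | hu
  · simpa using hv.le
  · have h := mul_le_mul_of_nonneg_left (Real.one_sub_inv_le_log_of_pos (div_pos hu hv)) hu.le
    have h' : u * (1 - (u / v)⁻¹) = u - v := by field_simp
    linarith

theorem lmax_pos {α : Type*} [Fintype α] [Nonempty α] {ℓ : α → ℝ} (hℓ : ∀ a, 0 < ℓ a) :
    0 < lmax ℓ := by
  obtain ⟨a⟩ := ‹Nonempty α›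
  exact (hℓ a).trans_le (Finset.le_sup' ℓ (Finset.mem_univ a))

theorem uMix_nonneg {α : Type*} [Fintype α] {ℓ π : α → ℝ} (hℓ : ∀ a, 0 < ℓ a)
    (hπ : ∀ a, 0 ≤ π a) (x : ℝ) : 0 ≤ uMix ℓ π x :=
  Finset.sum_nonneg fun a _ => mul_nonneg (div_nonneg (hπ a) (by linarith [hℓ a]))
    (Set.indicator_nonneg (fun _ _ => zero_le_one) x)

theorem uUnif_nonneg {α : Type*} [Fintype α] [Nonempty α] {ℓ : α → ℝ} (hℓ : ∀ a, 0 < ℓ a)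
    (x : ℝ) : 0 ≤ uUnif ℓ x :=
  mul_nonneg (div_nonneg zero_le_one (by linarith [lmax_pos hℓ]))
    (Set.indicator_nonneg (fun _ _ => zero_le_one) x)

theorem integrable_uUnif {α : Type*} [Fintype α] [Nonempty α] (ℓ : α → ℝ) :
    Integrable (uUnif ℓ) :=
  ((integrable_indicator_iff measurableSet_Icc).2
    (integrableOn_const measure_Icc_lt_top.ne)).const_mul _

theorem neg_integral_uUnif_le_KLdiv {α : Type*} [Fintype α] [Nonempty α] {ℓ π : α → ℝ}
    (hℓ : ∀ a, 0 < ℓ a) (hπ : ∀ a, 0 ≤ π a) : -∫ x, uUnif ℓ x ≤ KLdiv ℓ π := by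
  unfold KLdiv
  by_cases hi : Integrable fun x => uMix ℓ π x * Real.log (uMix ℓ π x / uUnif ℓ x)
  · rw [← integral_neg]
    refine integral_mono (integrable_uUnif ℓ).neg hi fun x => ?_
    rcases (uUnif_nonneg hℓ x).eq_or_lt with h | h
    · simp [← h]
    · have := sub_le_mul_log_div (uMix_nonneg hℓ hπ x) h
      have := uMix_nonneg hℓ hπ x
      simp only
      linarith
  · rw [integral_undef hi]
    exact neg_nonpos.2 (integral_nonneg (uUnif_nonneg hℓ))

theorem IsPolicy.sum_mul_le {α : Type*} [Fintype α] {π x : α → ℝ} {c : ℝ} (hπ : IsPolicy π)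
    (hx : ∀ a, x a ≤ c) : ∑ a, π a * x a ≤ c :=
  calc ∑ a, π a * x a ≤ ∑ a, π a * c :=
        Finset.sum_le_sum fun a _ => mul_le_mul_of_nonneg_left (hx a) (hπ.1 a)
    _ = c := by rw [← Finset.sum_mul, hπ.2, one_mul]

theorem exists_isPolicy (α : Type*) [Fintype α] [Nonempty α] : ∃ π : α → ℝ, IsPolicy π := by
  classical
  obtain ⟨a⟩ := ‹Nonempty α›
  exact ⟨Pi.single a 1, fun b => (Pi.single_nonneg.2 zero_le_one : (0 : α → ℝ) ≤ _) b, by simp⟩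

theorem bddAbove_softV {α : Type*} [Fintype α] [Nonempty α] {ℓ : α → ℝ} {κ : ℝ}
    (hℓ : ∀ a, 0 < ℓ a) (hκ : 0 ≤ κ) (x : α → ℝ) :
    BddAbove {y : ℝ | ∃ π, IsPolicy π ∧ y = (∑ a, π a * x a) - κ * KLdiv ℓ π} := by
  refine ⟨‖x‖ + κ * ∫ t, uUnif ℓ t, ?_⟩
  rintro y ⟨π, hπ, rfl⟩
  have h₁ := hπ.sum_mul_le fun a => (le_abs_self (x a)).trans (norm_le_pi_norm x a)
  have h₂ := mul_le_mul_of_nonneg_left (neg_integral_uUnif_le_KLdiv hℓ hπ.1) hκ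
  linarith

theorem softV_le_add {α : Type*} [Fintype α] [Nonempty α] {ℓ : α → ℝ} {κ : ℝ}
    (hℓ : ∀ a, 0 < ℓ a) (hκ : 0 ≤ κ) {x y : α → ℝ} {c : ℝ} (h : ∀ a, x a - y a ≤ c) :
    softV ℓ κ x ≤ softV ℓ κ y + c := by
  obtain ⟨π₀, hπ₀⟩ := exists_isPolicy α
  refine csSup_le ⟨_, π₀, hπ₀, rfl⟩ ?_
  rintro z ⟨π, hπ, rfl⟩
  have h₁ : (∑ a, π a * y a) - κ * KLdiv ℓ π ≤ softV ℓ κ y :=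
    le_csSup (bddAbove_softV hℓ hκ y) ⟨π, hπ, rfl⟩
  have h₂ := hπ.sum_mul_le h
  simp only [mul_sub, Finset.sum_sub_distrib] at h₂
  linarith

theorem abs_softV_sub_le {α : Type*} [Fintype α] [Nonempty α] {ℓ : α → ℝ} {κ : ℝ}
    (hℓ : ∀ a, 0 < ℓ a) (hκ : 0 ≤ κ) (x y : α → ℝ) :
    |softV ℓ κ x - softV ℓ κ y| ≤ dist x y := by
  have h₁ := softV_le_add hℓ hκ (x := x) (y := y) fun a =>
    (le_abs_self _).trans (dist_le_pi_dist x y a)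
  have h₂ := softV_le_add hℓ hκ (x := y) (y := x) fun a =>
    (le_abs_self _).trans (dist_le_pi_dist y x a)
  rw [dist_comm y x] at h₂
  exact abs_sub_le_iff.2 ⟨by linarith, by linarith⟩

theorem supNorm_sub_eq_dist {S A : Type*} [Fintype S] [Fintype A] [Nonempty S] [Nonempty A]
    (q₁ q₂ : S → A → ℝ) : supNorm (fun s a => q₁ s a - q₂ s a) = dist q₁ q₂ := by
  apply le_antisymm
  · exact Finset.sup'_le _ _ fun p _ =>
      (dist_le_pi_dist (q₁ p.1) (q₂ p.1) p.2).trans (dist_le_pi_dist q₁ q₂ p.1)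
  · exact dist_pi_le_iff'.2 fun s => dist_pi_le_iff'.2 fun a =>
      Finset.le_sup' (fun p : S × A => |q₁ p.1 p.2 - q₂ p.1 p.2|) (Finset.mem_univ (s, a))

theorem dist_Toper_le {S A : Type*} [Fintype S] [Fintype A] [Nonempty A]
    {P : S → A → S → ℝ} (hP : IsKernel P) (r : S → A → ℝ) {γ κ : ℝ} (hγ : 0 ≤ γ) (hκ : 0 ≤ κ)
    {ℓ : S → A → ℝ} (hℓ : ∀ s a, 0 < ℓ s a) (q₁ q₂ : S → A → ℝ) :
    dist (Toper P r γ κ ℓ q₁) (Toper P r γ κ ℓ q₂) ≤ γ * dist q₁ q₂ := by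
  have h0 : 0 ≤ γ * dist q₁ q₂ := mul_nonneg hγ dist_nonneg
  refine (dist_pi_le_iff h0).2 fun s => (dist_pi_le_iff h0).2 fun a => ?_
  have h : Toper P r γ κ ℓ q₁ s a - Toper P r γ κ ℓ q₂ s a =
      γ * ∑ s', P s a s' * (softV (ℓ s') κ (q₁ s') - softV (ℓ s') κ (q₂ s')) := by
    simp only [Toper, mul_sub, Finset.sum_sub_distrib]
    ring
  rw [Real.dist_eq, h, abs_mul, abs_of_nonneg hγ]
  refine mul_le_mul_of_nonneg_left ((Finset.abs_sum_le_sum_abs _ _).trans ?_) hγ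
  simp only [abs_mul, abs_of_nonneg ((hP s a).1 _)]
  exact IsPolicy.sum_mul_le (hP s a) fun s' =>
    (abs_softV_sub_le (hℓ s') hκ _ _).trans (dist_le_pi_dist q₁ q₂ s')

/-- `T^ℓ` is a `γ`-contraction in the sup norm; hence it has a
unique fixed point `q*` and value iteration converges to `q*` from any `q⁰`. -/
theorem Top_contraction_fixed_point (S A : Type*)
    [Fintype S] [Fintype A] [Nonempty S] [Nonempty A]
    (P : S → A → S → ℝ) (hP : IsKernel P) (r : S → A → ℝ)
    (γ : ℝ) (hγ0 : 0 ≤ γ) (hγ1 : γ < 1) (κ : ℝ) (hκ : 0 < κ)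
    (ℓ : S → A → ℝ) (hℓ : ∀ s a, 0 < ℓ s a) :
    (∀ q₁ q₂ : S → A → ℝ,
      supNorm (fun s a => Toper P r γ κ ℓ q₁ s a - Toper P r γ κ ℓ q₂ s a) ≤
        γ * supNorm (fun s a => q₁ s a - q₂ s a)) ∧
    ∃ qstar : S → A → ℝ, Toper P r γ κ ℓ qstar = qstar ∧
      (∀ q', Toper P r γ κ ℓ q' = q' → q' = qstar) ∧
      ∀ q₀ : S → A → ℝ, ∀ s a,
        Filter.Tendsto (fun n => (Toper P r γ κ ℓ)^[n] q₀ s a)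
          Filter.atTop (nhds (qstar s a)) := by
  simp only [supNorm_sub_eq_dist]
  have hd := dist_Toper_le hP r hγ0 hκ.le hℓ
  have hT : ContractingWith ⟨γ, hγ0⟩ (Toper P r γ κ ℓ) :=
    ⟨by exact_mod_cast hγ1, LipschitzWith.of_dist_le_mul hd⟩
  refine ⟨hd, hT.fixedPoint, hT.fixedPoint_isFixedPt, fun q' hq' => hT.fixedPoint_unique hq',
    fun q₀ s a => ?_⟩
  exact tendsto_pi_nhds.1 (tendsto_pi_nhds.1 (hT.tendsto_iterate_fixedPoint q₀) s) a
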